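/- arXiv:1001.4241 — 3 statements merged into one kernel-verified Lean document; each statement's English description precedes it below -/
import Mathlib

section
/- Let C2 ≥ C1 > 0 and r1 > 1 be constants, and define λ1(r) = C1/(r²(log r)²) and λ2(r) = C2/(r²(log r)²) for r > 1. Then there exist constants c0 > 1, δ > 0, b1 > 0, b2 > 0 and r0 ≥ r1 such that: (2) ∫_r^{c0·r} √(λ1(ρ)) dρ ≥ π·r·√(λ2(r)) for all r ≥ r0; (3) r·√(λ1(c0·r)) ≥ b1·∫_r^∞ ρ·λ2(ρ) dρ for all r ≥ r0; (4) ∫_r^{r²} √(λ1(ρ)) dρ ≥ b2 for all r ≥ r0; and (5) λ1(c0·r) ≥ δ·λ2(r) for all r ≥ r0. -/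
open MeasureTheory Set Real

lemma sqrt_div_sq_mul_log_sq {C r : ℝ} (hr : 1 < r) :
    √(C / (r ^ 2 * Real.log r ^ 2)) = √C / (r * Real.log r) := by
  have hl : 0 < Real.log r := Real.log_pos hr
  rw [← mul_pow, Real.sqrt_div' _ (by positivity), Real.sqrt_sq (by positivity)]

lemma integral_div_mul_log {K r s : ℝ} (hr : 1 < r) (hrs : r ≤ s) :
    ∫ ρ in r..s, K / (ρ * Real.log ρ) = K * Real.log (Real.log s / Real.log r) := by
  have hpos : ∀ ρ ∈ uIcc r s, 0 < ρ ∧ 0 < Real.log ρ := fun ρ hρ => by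
    rw [uIcc_of_le hrs] at hρ
    exact ⟨by linarith [hρ.1], Real.log_pos (by linarith [hρ.1])⟩
  have hderiv : ∀ ρ ∈ uIcc r s,
      HasDerivAt (fun x => K * Real.log (Real.log x)) (K / (ρ * Real.log ρ)) ρ := fun ρ hρ => by
    obtain ⟨h₁, h₂⟩ := hpos ρ hρ
    refine (((Real.hasDerivAt_log h₁.ne').log h₂.ne').const_mul K).congr_deriv ?_
    field_simp
  rw [intervalIntegral.integral_eq_sub_of_hasDerivAt hderiv, ← mul_sub,
    Real.log_div (hpos s right_mem_uIcc).2.ne' (hpos r left_mem_uIcc).2.ne']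
  refine ContinuousOn.intervalIntegrable fun ρ hρ => ContinuousAt.continuousWithinAt ?_
  obtain ⟨h₁, h₂⟩ := hpos ρ hρ
  exact continuousAt_const.div (continuousAt_id.mul (Real.continuousAt_log h₁.ne'))
    (mul_pos h₁ h₂).ne'

lemma lintegral_Ioi_div_mul_log_sq {C r : ℝ} (hC : 0 ≤ C) (hr : 1 < r) :
    ∫⁻ ρ in Ioi r, ENNReal.ofReal (C / (ρ * Real.log ρ ^ 2)) =
      ENNReal.ofReal (C / Real.log r) := by
  have hderiv : ∀ ρ ∈ Ici r,
      HasDerivAt (fun x => -C * (Real.log x)⁻¹) (C / (ρ * Real.log ρ ^ 2)) ρ := fun ρ hρ => by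
    have h₁ : 1 < ρ := hr.trans_le hρ
    have h₂ : 0 < Real.log ρ := Real.log_pos h₁
    refine (((Real.hasDerivAt_log (by positivity)).fun_inv h₂.ne').const_mul (-C)).congr_deriv ?_
    field_simp
  have hnonneg : ∀ ρ ∈ Ioi r, 0 ≤ C / (ρ * Real.log ρ ^ 2) := fun ρ hρ => by
    have h₁ : 0 < ρ := by linarith [mem_Ioi.1 hρ]
    positivity
  have hlim : Filter.Tendsto (fun x => -C * (Real.log x)⁻¹) Filter.atTop (nhds 0) := by
    simpa using (Filter.Tendsto.inv_tendsto_atTop Real.tendsto_log_atTop).const_mul (-C)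
  rw [← ofReal_integral_eq_lintegral_ofReal
      (integrableOn_Ioi_deriv_of_nonneg' hderiv hnonneg hlim)
      ((ae_restrict_iff' measurableSet_Ioi).2 (Filter.Eventually.of_forall hnonneg)),
    integral_Ioi_of_hasDerivAt_of_nonneg' hderiv hnonneg hlim]
  congr 1
  ring

/-- **Proposition 2.** If `λ1(r) = C1/(r² (log r)²)` and `λ2(r) = C2/(r² (log r)²)`
with `C2 ≥ C1 > 0` and `r1 > 1`, then there exist constants `c0 > 1`, `δ > 0`,
`b1 > 0`, `b2 > 0` and `r0 ≥ r1` for which conditions (2), (3), (4) and (5) hold. -/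
theorem conditions_for_log_decay_metric (C1 C2 r1 : ℝ)
    (hC1 : 0 < C1) (hC12 : C1 ≤ C2) (hr1 : 1 < r1)
    (lam1 lam2 : ℝ → ℝ)
    (hlam1 : ∀ r : ℝ, 1 < r → lam1 r = C1 / (r ^ 2 * (Real.log r) ^ 2))
    (hlam2 : ∀ r : ℝ, 1 < r → lam2 r = C2 / (r ^ 2 * (Real.log r) ^ 2)) :
    ∃ c0 δ b1 b2 r0 : ℝ, 1 < c0 ∧ 0 < δ ∧ 0 < b1 ∧ 0 < b2 ∧ r1 ≤ r0 ∧
      -- condition (2)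
      (∀ r : ℝ, r0 ≤ r →
        Real.pi * r * Real.sqrt (lam2 r) ≤ ∫ ρ in r..(c0 * r), Real.sqrt (lam1 ρ)) ∧
      -- condition (3)
      (∀ r : ℝ, r0 ≤ r →
        ENNReal.ofReal b1 * (∫⁻ ρ in Ioi r, ENNReal.ofReal (ρ * lam2 ρ))
          ≤ ENNReal.ofReal (r * Real.sqrt (lam1 (c0 * r)))) ∧
      -- condition (4)
      (∀ r : ℝ, r0 ≤ r → b2 ≤ ∫ ρ in r..(r ^ 2), Real.sqrt (lam1 ρ)) ∧
      -- condition (5)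
      (∀ r : ℝ, r0 ≤ r → δ * lam2 r ≤ lam1 (c0 * r)) := by
  have hC2 : 0 < C2 := hC1.trans_le hC12
  have hs1 : 0 < √C1 := Real.sqrt_pos.2 hC1
  have hs2 : 0 < √C2 := Real.sqrt_pos.2 hC2
  obtain ⟨L, hL⟩ : ∃ L, L = 2 * π * √C2 / √C1 := ⟨_, rfl⟩
  have hLpos : 0 < L := by rw [hL]; positivity
  obtain ⟨c, hc⟩ : ∃ c, c = Real.exp L := ⟨_, rfl⟩
  have hc1 : 1 < c := hc ▸ Real.one_lt_exp_iff.2 hLpos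
  have hlogc : Real.log c = L := by rw [hc, Real.log_exp]
  have key : ∀ r, max r1 c ≤ r → 1 < r ∧ r < c * r ∧ 0 < Real.log r ∧
      Real.log (c * r) = L + Real.log r ∧ L ≤ Real.log r := fun r hr => by
    have hcr : c ≤ r := (le_max_right _ _).trans hr
    have hr1' : 1 < r := hc1.trans_le hcr
    refine ⟨hr1', by nlinarith, Real.log_pos hr1', ?_, ?_⟩
    · rw [Real.log_mul (by positivity) (by positivity), hlogc]
    · rw [← hlogc]
      exact Real.log_le_log (by positivity) hcr
  have hint : ∀ r s, 1 < r → r ≤ s →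
      ∫ ρ in r..s, √(lam1 ρ) = √C1 * Real.log (Real.log s / Real.log r) := fun r s hr hrs => by
    rw [← integral_div_mul_log hr hrs]
    refine intervalIntegral.integral_congr fun ρ hρ => ?_
    rw [uIcc_of_le hrs] at hρ
    have hρ1 : 1 < ρ := hr.trans_le hρ.1
    simp only [hlam1 ρ hρ1, sqrt_div_sq_mul_log_sq hρ1]
  refine ⟨c, C1 / (4 * c ^ 2 * C2), √C1 / (2 * c * C2), √C1 * Real.log 2, max r1 c, hc1,
    by positivity, by positivity, mul_pos hs1 (Real.log_pos one_lt_two), le_max_left _ _,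
    fun r hr => ?_, fun r hr => ?_, fun r hr => ?_, fun r hr => ?_⟩
  all_goals obtain ⟨h1, hcr, hl, hlog, hLl⟩ := key r hr
  · rw [hint r _ h1 hcr.le, hlam2 r h1, sqrt_div_sq_mul_log_sq h1, hlog]
    have hbound : L / (2 * Real.log r) ≤ Real.log ((L + Real.log r) / Real.log r) := by
      refine le_trans ?_ (Real.one_sub_inv_le_log_of_pos (by positivity))
      have : 1 - ((L + Real.log r) / Real.log r)⁻¹ = L / (L + Real.log r) := by
        field_simp
        ring
      rw [this]
      gcongr
      linarith
    calc π * r * (√C2 / (r * Real.log r)) = √C1 * (L / (2 * Real.log r)) := by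
          rw [hL]
          field_simp
      _ ≤ _ := by gcongr
  · have heq : ∫⁻ ρ in Ioi r, ENNReal.ofReal (ρ * lam2 ρ) = ENNReal.ofReal (C2 / Real.log r) := by
      rw [← lintegral_Ioi_div_mul_log_sq hC2.le h1]
      refine setLIntegral_congr_fun measurableSet_Ioi fun ρ hρ => ?_
      have hρ1 : 1 < ρ := h1.trans hρ
      have hρl : 0 < Real.log ρ := Real.log_pos hρ1
      simp only [hlam2 ρ hρ1]
      congr 1
      field_simp
    rw [heq, ← ENNReal.ofReal_mul (by positivity), hlam1 _ (h1.trans hcr),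
      sqrt_div_sq_mul_log_sq (h1.trans hcr), hlog]
    apply ENNReal.ofReal_le_ofReal
    calc √C1 / (2 * c * C2) * (C2 / Real.log r) = √C1 / (c * (2 * Real.log r)) := by
          field_simp
      _ ≤ √C1 / (c * (L + Real.log r)) := by
          gcongr
          linarith
      _ = r * (√C1 / (c * r * (L + Real.log r))) := by
          field_simp
  · rw [hint r _ h1 (by nlinarith), Real.log_pow, Nat.cast_ofNat, mul_div_cancel_right₀ _ hl.ne']
  · rw [hlam2 r h1, hlam1 _ (h1.trans hcr), hlog]
    calc C1 / (4 * c ^ 2 * C2) * (C2 / (r ^ 2 * Real.log r ^ 2))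
        = C1 / ((c * r) ^ 2 * (2 * Real.log r) ^ 2) := by
          field_simp
          ring
      _ ≤ C1 / ((c * r) ^ 2 * (L + Real.log r) ^ 2) := by
          gcongr
          linarith
end

section
/- Let g be a continuous Riemannian metric on ℝ² with finite total area A, and suppose c1·Id ≤ g(x) ≤ c2·Id as quadratic forms for all x in a closed Euclidean ball B̄_R centered at the origin, where c2 ≥ c1 > 0. Let C1 > 0. Then there exists a constant δ1 > 0 (one may take δ1 = 4π·c1/(c2·C1)) such that every piecewise C¹ simple closed curve γ with image contained in B̄_R satisfying the planar isoperimetric inequality 4π·|Ω_γ| ≤ L_e(γ)² (where Ω_γ is the union of the bounded connected components of the complement of the image of γ, |Ω_γ| its Lebesgue area, and L_e(γ) its Euclidean length) and satisfying I(γ) < C1, has L_g(γ) ≥ δ1. -/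
open MeasureTheory Set Real

noncomputable section

abbrev E2 := EuclideanSpace ℝ (Fin 2)

/-- The quadratic form associated to a 2×2 matrix. -/
def qf (M : Matrix (Fin 2) (Fin 2) ℝ) (v : E2) : ℝ :=
  ∑ i, ∑ j, M i j * v i * v j

/-- A continuous Riemannian metric on ℝ²: a continuous field of symmetric
positive definite 2×2 matrices. -/
def IsRiemMetric (g : E2 → Matrix (Fin 2) (Fin 2) ℝ) : Prop :=
  Continuous g ∧ (∀ x, (g x).IsSymm) ∧ ∀ x, ∀ v : E2, v ≠ 0 → 0 < qf (g x) v

/-- A piecewise C¹ curve in ℝ²: continuous on `[a,b]` and differentiable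
outside a finite set. -/
structure PC1Curve where
  a : ℝ
  b : ℝ
  hab : a < b
  toFun : ℝ → E2
  cont : ContinuousOn toFun (Icc a b)
  sm : ∃ s : Finset ℝ, ∀ t ∈ Icc a b, t ∉ s → DifferentiableAt ℝ toFun t

def PC1Curve.IsSimpleClosed (c : PC1Curve) : Prop :=
  c.toFun c.a = c.toFun c.b ∧ InjOn c.toFun (Ico c.a c.b)

def PC1Curve.image (c : PC1Curve) : Set E2 := c.toFun '' (Icc c.a c.b)

/-- Union of the bounded connected components of the complement of the image. -/
def PC1Curve.interiorRegion (c : PC1Curve) : Set E2 :=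
  {x | x ∉ c.image ∧ Bornology.IsBounded (connectedComponentIn c.imageᶜ x)}

/-- Length of a curve with respect to the metric `g`. -/
def Lg (g : E2 → Matrix (Fin 2) (Fin 2) ℝ) (c : PC1Curve) : ℝ :=
  ∫ t in c.a..c.b, Real.sqrt (qf (g (c.toFun t)) (deriv c.toFun t))

/-- Euclidean length of a curve. -/
def Le (c : PC1Curve) : ℝ :=
  ∫ t in c.a..c.b, ‖deriv c.toFun t‖

/-- Area density `√(det g)` of the metric `g`. -/
def areaDensity (g : E2 → Matrix (Fin 2) (Fin 2) ℝ) (x : E2) : ℝ :=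
  Real.sqrt ((g x).det)

/-- Total area of ℝ² with respect to `g`. -/
def totalArea (g : E2 → Matrix (Fin 2) (Fin 2) ℝ) : ℝ :=
  ∫ x, areaDensity g x

/-- Area inside a closed curve with respect to `g`. -/
def Ain (g : E2 → Matrix (Fin 2) (Fin 2) ℝ) (c : PC1Curve) : ℝ :=
  ∫ x in c.interiorRegion, areaDensity g x

/-- Area outside a closed curve with respect to `g`. -/
def Aout (g : E2 → Matrix (Fin 2) (Fin 2) ℝ) (c : PC1Curve) : ℝ :=
  totalArea g - Ain g c

/-- The isoperimetric ratio `I(γ)`. -/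
def Iratio (g : E2 → Matrix (Fin 2) (Fin 2) ℝ) (c : PC1Curve) : ℝ :=
  Lg g c * (1 / Ain g c + 1 / Aout g c)

/-- The isoperimetric constant `I_g`: infimum of `I(γ)` over piecewise C¹
simple closed curves. -/
def Ig (g : E2 → Matrix (Fin 2) (Fin 2) ℝ) : ℝ :=
  sInf {r | ∃ c : PC1Curve, c.IsSimpleClosed ∧ Iratio g c = r}


/-- Two continuous logarithms of the same function on an interval differ by a constant. -/
lemma log_sub_log_eq {p q : ℝ} (hpq : p ≤ q) {L₁ L₂ : ℝ → ℂ}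
    (h₁ : ContinuousOn L₁ (Icc p q)) (h₂ : ContinuousOn L₂ (Icc p q))
    (h : ∀ t ∈ Icc p q, Complex.exp (L₁ t) = Complex.exp (L₂ t)) :
    L₁ p - L₂ p = L₁ q - L₂ q := by
  have hT : IsDiscrete (range ((↑) : ℤ → ℝ)) :=
    Int.isClosedEmbedding_coe_real.isInducing.isDiscrete_range
  choose! n hn using fun t ht => Complex.exp_eq_exp_iff_exists_int.1 (h t ht)
  have him : ∀ t ∈ Icc p q, (L₁ t - L₂ t).im / (2 * π) = n t := by
    intro t ht
    rw [hn t ht]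
    simp
  have hc : ContinuousOn (fun t => (L₁ t - L₂ t).im / (2 * π)) (Icc p q) :=
    (Complex.continuous_im.comp_continuousOn (h₁.sub h₂)).div_const _
  have := isPreconnected_Icc.constant_of_mapsTo hT hc
    (fun t ht => ⟨n t, (him t ht).symm⟩) (left_mem_Icc.2 hpq) (right_mem_Icc.2 hpq)
  simp only [him p (left_mem_Icc.2 hpq), him q (right_mem_Icc.2 hpq), Int.cast_inj] at this
  rw [hn p (left_mem_Icc.2 hpq), hn q (right_mem_Icc.2 hpq), this]
  ring

/-- If `x` and `y` lie in a connected subset of the complement of a compact set `K`, then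
`(z - x) / (z - y)` has a continuous logarithm on `K`. -/
lemma exists_log_of_isPreconnected {K U : Set ℂ} (hK : IsCompact K) (hU : IsPreconnected U)
    (hUK : U ⊆ Kᶜ) {x y : ℂ} (hx : x ∈ U) (hy : y ∈ U) :
    ∃ L : ℂ → ℂ, ContinuousOn L K ∧ ∀ z ∈ K, Complex.exp (L z) = (z - x) / (z - y) := by
  have hne : ∀ {x z}, x ∈ U → z ∈ K → z - x ≠ 0 := fun hx hz h =>
    hUK hx (sub_eq_zero.1 h ▸ hz)
  refine hU.induction₂ (fun x y => ∃ L : ℂ → ℂ, ContinuousOn L K ∧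
    ∀ z ∈ K, Complex.exp (L z) = (z - x) / (z - y)) ?_ ?_ ?_ hx hy
  · intro x hx
    obtain ⟨r, hr, hball⟩ := Metric.isOpen_iff.1 hK.isClosed.isOpen_compl x (hUK hx)
    filter_upwards [self_mem_nhdsWithin,
      mem_nhdsWithin_of_mem_nhds (Metric.ball_mem_nhds x (half_pos hr))] with y hy hyx
    have hlt : ∀ z ∈ K, ‖(z - x) / (z - y) - 1‖ < 1 := by
      intro z hz
      have hzx : r ≤ ‖z - x‖ := by
        by_contra! hlt
        exact hball (by rwa [Metric.mem_ball, dist_eq_norm]) hz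
      rw [Metric.mem_ball, dist_eq_norm] at hyx
      have htri : ‖z - x‖ ≤ ‖z - y‖ + ‖y - x‖ := by simpa using norm_add_le (z - y) (y - x)
      have : (z - x) / (z - y) - 1 = (y - x) / (z - y) := by
        field_simp [hne hy hz]
        ring
      rw [this, norm_div, div_lt_one (norm_pos_iff.2 (hne hy hz))]
      linarith
    have hslit : ∀ z ∈ K, (z - x) / (z - y) ∈ Complex.slitPlane := fun z hz =>
      Complex.ball_one_subset_slitPlane (by
        rw [Metric.mem_ball, dist_eq_norm]
        exact hlt z hz)
    refine ⟨fun z => Complex.log ((z - x) / (z - y)), ?_, fun z hz =>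
      Complex.exp_log (div_ne_zero (hne hx hz) (hne hy hz))⟩
    refine ContinuousOn.clog (ContinuousOn.div (by fun_prop) (by fun_prop) fun z hz => hne hy hz)
      hslit
  · rintro x y z hx hy hz ⟨L₁, h₁, e₁⟩ ⟨L₂, h₂, e₂⟩
    refine ⟨fun w => L₁ w + L₂ w, h₁.add h₂, fun w hw => ?_⟩
    rw [Complex.exp_add, e₁ w hw, e₂ w hw, div_mul_div_cancel₀ (hne hy hw)]
  · rintro x y hx hy ⟨L, h, e⟩
    refine ⟨fun w => -L w, h.neg, fun w hw => ?_⟩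
    rw [Complex.exp_neg, e w hw, inv_div]

lemma div_mul_I_im (z : ℂ) (ε : ℝ) :
    ((z - ε * Complex.I) / (z + ε * Complex.I)).im =
      -(2 * ε * z.re) / Complex.normSq (z + ε * Complex.I) := by
  rw [Complex.div_im]
  simp
  ring

lemma div_mul_I_re (z : ℂ) (ε : ℝ) :
    ((z - ε * Complex.I) / (z + ε * Complex.I)).re =
      (‖z‖ ^ 2 - ε ^ 2) / Complex.normSq (z + ε * Complex.I) := by
  rw [Complex.div_re, ← Complex.normSq_eq_norm_sq, Complex.normSq_apply z]
  simp
  ring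

/-- A closed curve which crosses the imaginary axis transversally at the origin, and otherwise
meets it only outside the disc of radius `ε`, has different winding numbers around the points
`±εi`. -/
lemma not_exists_log_of_crossing {w : ℝ → ℂ} {a l t₀ r b ε : ℝ} (hal : a ≤ l) (hlt : l < t₀)
    (htr : t₀ < r) (hrb : r ≤ b) (hε : 0 < ε) (hw : ContinuousOn w (Icc a b)) (hab : w a = w b)
    (h₀ : w t₀ = 0) (hneg : ∀ t ∈ Ico l t₀, (w t).re < 0) (hpos : ∀ t ∈ Ioc t₀ r, 0 < (w t).re)
    (hl : ∀ t ∈ Icc a l, ε < ‖w t‖) (hr : ∀ t ∈ Icc r b, ε < ‖w t‖) :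
    ¬ ∃ L : ℂ → ℂ, ContinuousOn L (w '' Icc a b) ∧ ∀ z ∈ w '' Icc a b,
      Complex.exp (L z) = (z - ε * Complex.I) / (z + ε * Complex.I) := by
  rintro ⟨L, hL, hexp⟩
  set f : ℝ → ℂ := fun t => (w t - ε * Complex.I) / (w t + ε * Complex.I) with hf
  have hfne : ∀ t ∈ Icc a b, f t ≠ 0 := fun t ht h0 => by
    have := hexp _ (mem_image_of_mem w ht)
    exact Complex.exp_ne_zero _ (this.trans h0)
  have hden : ∀ t ∈ Icc a b, w t + ε * Complex.I ≠ 0 := fun t ht h0 => by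
    apply hfne t ht
    simp [hf, h0]
  have hnsq : ∀ t ∈ Icc a b, 0 < Complex.normSq (w t + ε * Complex.I) := fun t ht =>
    Complex.normSq_pos.2 (hden t ht)
  have hfc : ContinuousOn f (Icc a b) := (hw.sub continuousOn_const).div
    (hw.add continuousOn_const) hden
  have hLw : ContinuousOn (fun t => L (w t)) (Icc a b) := hL.comp hw (mapsTo_image _ _)
  have houter : ∀ t ∈ Icc a b, ε < ‖w t‖ → f t ∈ Complex.slitPlane := by
    intro t ht hlt
    refine Complex.mem_slitPlane_iff.2 (Or.inl ?_)
    rw [hf, div_mul_I_re]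
    exact div_pos (by nlinarith) (hnsq t ht)
  have hI1 : Icc a l ⊆ Icc a b := Icc_subset_Icc_right (by linarith)
  have hI2 : Icc r b ⊆ Icc a b := Icc_subset_Icc_left (by linarith)
  have hI3 : Icc l r ⊆ Icc a b := Icc_subset_Icc hal hrb
  have him_neg : ∀ t ∈ Icc a b, 0 < (w t).re → (f t).im < 0 := by
    intro t ht h
    rw [hf, div_mul_I_im]
    exact div_neg_of_neg_of_pos (by nlinarith [mul_pos hε h]) (hnsq t ht)
  have him_pos : ∀ t ∈ Icc a b, (w t).re < 0 → 0 < (f t).im := by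
    intro t ht h
    rw [hf, div_mul_I_im]
    exact div_pos (by nlinarith [mul_pos hε (neg_pos.2 h)]) (hnsq t ht)
  have hinner : ∀ t ∈ Icc l r, -f t ∈ Complex.slitPlane := by
    intro t ht
    rcases lt_trichotomy t t₀ with h | rfl | h
    · refine Complex.mem_slitPlane_iff.2 (Or.inr ?_)
      simpa using (him_pos t (hI3 ht) (hneg t ⟨ht.1, h⟩)).ne'
    · refine Complex.mem_slitPlane_iff.2 (Or.inl ?_)
      rw [Complex.neg_re, hf, div_mul_I_re, h₀, ← neg_div]
      refine div_pos ?_ (h₀ ▸ hnsq t (hI3 ht))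
      simpa using pow_pos hε 2
    · refine Complex.mem_slitPlane_iff.2 (Or.inr ?_)
      simpa using (him_neg t (hI3 ht) (hpos t ⟨h, ht.2⟩)).ne
  have e1 := log_sub_log_eq hal (hLw.mono hI1)
    ((hfc.mono hI1).clog fun t ht => houter t (hI1 ht) (hl t ht)) fun t ht => by
      rw [Complex.exp_log (hfne t (hI1 ht)), hexp _ (mem_image_of_mem w (hI1 ht))]
  have e2 := log_sub_log_eq hrb (hLw.mono hI2)
    ((hfc.mono hI2).clog fun t ht => houter t (hI2 ht) (hr t ht)) fun t ht => by
      rw [Complex.exp_log (hfne t (hI2 ht)), hexp _ (mem_image_of_mem w (hI2 ht))]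
  have e3 := log_sub_log_eq (hlt.trans htr).le
    ((hLw.mono hI3).add (continuousOn_const (c := (π : ℂ) * Complex.I)))
    ((hfc.mono hI3).neg.clog hinner) fun t ht => by
      rw [Pi.add_apply, Complex.exp_add, Complex.exp_pi_mul_I, Pi.neg_apply,
        Complex.exp_log (neg_ne_zero.2 (hfne t (hI3 ht))),
        hexp _ (mem_image_of_mem w (hI3 ht))]
      simp [hf]
  have hfab : f a = f b := by simp [hf, hab]
  have hargl : (Complex.log (-f l)).im = (Complex.log (f l)).im - π := by
    simp only [Complex.log_im]
    exact Complex.arg_neg_eq_arg_sub_pi_of_im_pos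
      (him_pos l (hI3 ⟨le_rfl, by linarith⟩) (hneg l ⟨le_rfl, hlt⟩))
  have hargr : (Complex.log (-f r)).im = (Complex.log (f r)).im + π := by
    simp only [Complex.log_im]
    exact Complex.arg_neg_eq_arg_add_pi_of_im_neg
      (him_neg r (hI3 ⟨by linarith, le_rfl⟩) (hpos r ⟨htr, le_rfl⟩))
  have e1' := congrArg Complex.im e1
  have e2' := congrArg Complex.im e2
  have e3' := congrArg Complex.im e3
  simp only [hab, hfab, Pi.add_apply, Pi.neg_apply, Complex.sub_im, Complex.add_im] at e1' e2' e3'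
  rw [hargl, hargr] at e3'
  linarith [Real.pi_pos]

/-- A simple closed curve with a regular point separates the plane. -/
lemma exists_separated_of_hasDerivAt {γ : ℝ → ℂ} {a b t₀ : ℝ} {d : ℂ} (ht₀ : t₀ ∈ Ioo a b)
    (hγ : ContinuousOn γ (Icc a b)) (hab : γ a = γ b) (hinj : InjOn γ (Ico a b))
    (hd : HasDerivAt γ d t₀) (hd0 : d ≠ 0) :
    ∃ x ∈ (γ '' Icc a b)ᶜ, ∃ y ∈ (γ '' Icc a b)ᶜ, ∀ U ⊆ (γ '' Icc a b)ᶜ, IsPreconnected U →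
      x ∈ U → y ∉ U := by
  set A : ℂ → ℂ := fun z => (z - γ t₀) / d with hA
  have hAc : Continuous A := by fun_prop
  have hAinj : Function.Injective A := fun z z' h => by
    simpa [hA, div_left_inj' hd0] using h
  set w : ℝ → ℂ := fun t => A (γ t) with hw
  have hwc : ContinuousOn w (Icc a b) := hAc.comp_continuousOn hγ
  have hw0 : w t₀ = 0 := by simp [hw, hA]
  have hne : ∀ t ∈ Icc a b, t ≠ t₀ → w t ≠ 0 := by
    intro t ht hne h0
    have heq : γ t = γ t₀ := hAinj (h0.trans hw0.symm)
    rcases ht.2.lt_or_eq with hlt | rfl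
    · exact hne (hinj ⟨ht.1, hlt⟩ ⟨ht₀.1.le, ht₀.2⟩ heq)
    · exact ht₀.1.ne (hinj ⟨le_rfl, ht₀.1.trans ht₀.2⟩ ⟨ht₀.1.le, ht₀.2⟩ (hab.trans heq))
  have hdw : HasDerivAt w 1 t₀ := by
    simpa [hd0] using (hd.sub_const (γ t₀)).div_const d
  have hre : HasDerivAt (fun t => (w t).re) 1 t₀ := by
    exact Complex.reCLM.hasFDerivAt.comp_hasDerivAt t₀ hdw
  have hslope := (hasDerivAt_iff_tendsto_slope.1 hre).eventually (lt_mem_nhds one_pos)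
  obtain ⟨η, hη, hball⟩ := Metric.eventually_nhds_iff.1 (eventually_nhdsWithin_iff.1 hslope)
  obtain ⟨δ, hδ, hδ'⟩ : ∃ δ, 0 < δ ∧ δ < min η (min (t₀ - a) (b - t₀)) :=
    exists_between (lt_min hη (lt_min (sub_pos.2 ht₀.1) (sub_pos.2 ht₀.2)))
  simp only [lt_min_iff] at hδ'
  obtain ⟨hδη, hδa, hδb⟩ := hδ'
  have hsl : ∀ t, |t - t₀| ≤ δ → t ≠ t₀ → 0 < (w t).re / (t - t₀) := by
    intro t ht hne
    have := hball (by rw [Real.dist_eq]; linarith : dist t t₀ < η) hne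
    simpa [slope_def_field, hw0] using this
  have hneg : ∀ t ∈ Ico (t₀ - δ) t₀, (w t).re < 0 := by
    intro t ht
    have := hsl t (abs_le.2 ⟨by linarith [ht.1], by linarith [ht.2]⟩) ht.2.ne
    exact (div_pos_iff.1 this).elim (fun h => absurd h.2 (by linarith [ht.2])) And.left
  have hpos : ∀ t ∈ Ioc t₀ (t₀ + δ), 0 < (w t).re := by
    intro t ht
    have := hsl t (abs_le.2 ⟨by linarith [ht.1], by linarith [ht.2]⟩) ht.1.ne'
    exact (div_pos_iff_of_pos_right (sub_pos.2 ht.1)).1 this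
  obtain ⟨m, hm, hmle⟩ := (isCompact_Icc (a := a) (b := t₀ - δ)).union
    (isCompact_Icc (a := t₀ + δ) (b := b)) |>.exists_forall_le' (f := fun t => ‖w t‖)
      (hwc.norm.mono (union_subset (Icc_subset_Icc_right (by linarith))
        (Icc_subset_Icc_left (by linarith)))) (a := 0) (by
        rintro t (ht | ht)
        · exact norm_pos_iff.2 (hne t ⟨ht.1, by linarith [ht.2]⟩ (by linarith [ht.2] : t < t₀).ne)
        · exact norm_pos_iff.2
            (hne t ⟨by linarith [ht.1], ht.2⟩ (by linarith [ht.1] : t₀ < t).ne'))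
  set ε : ℝ := m / 2 with hε
  have hε0 : 0 < ε := half_pos hm
  have hεm : ε < m := half_lt_self hm
  have hl : ∀ t ∈ Icc a (t₀ - δ), ε < ‖w t‖ := fun t ht => hεm.trans_le (hmle t (Or.inl ht))
  have hr : ∀ t ∈ Icc (t₀ + δ) b, ε < ‖w t‖ := fun t ht => hεm.trans_le (hmle t (Or.inr ht))
  have hnot : ∀ z : ℂ, z.re = 0 → ‖z‖ = ε → ∀ t ∈ Icc a b, w t ≠ z := by
    rintro z hz hzn t ht rfl
    rcases le_or_gt t (t₀ - δ) with h1 | h1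
    · exact (hl t ⟨ht.1, h1⟩).ne' hzn
    rcases le_or_gt (t₀ + δ) t with h2 | h2
    · exact (hr t ⟨h2, ht.2⟩).ne' hzn
    rcases lt_trichotomy t t₀ with h | rfl | h
    · exact (hneg t ⟨h1.le, h⟩).ne hz
    · rw [hw0, norm_zero] at hzn
      exact hε0.ne hzn
    · exact (hpos t ⟨h, h2.le⟩).ne' hz
  have hAsymm : ∀ u : ℂ, A (γ t₀ + d * u) = u := fun u => by simp [hA, hd0]
  have hmem : ∀ u : ℂ, u.re = 0 → ‖u‖ = ε → γ t₀ + d * u ∈ (γ '' Icc a b)ᶜ := by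
    rintro u hu hun ⟨t, ht, hte⟩
    exact hnot u hu hun t ht (by rw [hw, ← hAsymm u, ← hte])
  refine ⟨γ t₀ + d * (ε * Complex.I), hmem _ (by simp) (by simp [abs_of_pos hε0]),
    γ t₀ + d * (-(ε * Complex.I)), hmem _ (by simp) (by simp [abs_of_pos hε0]),
    fun U hUK hU hxU hyU => ?_⟩
  obtain ⟨L, hL, hexp⟩ := exists_log_of_isPreconnected (isCompact_Icc.image_of_continuousOn hwc)
    (hU.image A hAc.continuousOn) (by
      rintro _ ⟨u, hu, rfl⟩ ⟨t, ht, hte⟩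
      exact hUK hu ⟨t, ht, hAinj hte⟩) (mem_image_of_mem A hxU) (mem_image_of_mem A hyU)
  rw [hAsymm, hAsymm] at hexp
  refine not_exists_log_of_crossing (by linarith) (by linarith) (by linarith) (by linarith) hε0
    hwc (by rw [hw]; simp only [hab]) hw0 hneg hpos hl hr ⟨L, hL, fun z hz => ?_⟩
  rw [hexp z hz, sub_neg_eq_add]

lemma isPreconnected_compl_closedBall_zero {E : Type*} [NormedAddCommGroup E] [NormedSpace ℝ E]
    (hE : 1 < Module.rank ℝ E) {r : ℝ} (hr : 0 ≤ r) :
    IsPreconnected (Metric.closedBall (0 : E) r)ᶜ := by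
  have himage : (Metric.closedBall (0 : E) r)ᶜ =
      (fun p : ℝ × E => p.1 • p.2) '' (Ioi r ×ˢ Metric.sphere 0 1) := by
    ext x
    simp only [mem_compl_iff, mem_closedBall_zero_iff, not_le, mem_image, mem_prod, mem_Ioi,
      mem_sphere_zero_iff_norm, Prod.exists]
    constructor
    · intro hx
      have hx0 : ‖x‖ ≠ 0 := (hr.trans_lt hx).ne'
      exact ⟨‖x‖, ‖x‖⁻¹ • x, ⟨hx, by simp [norm_smul, hx0]⟩, smul_inv_smul₀ hx0 x⟩
    · rintro ⟨s, v, ⟨hs, hv⟩, rfl⟩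
      rwa [norm_smul, hv, mul_one, Real.norm_of_nonneg (hr.trans hs.le)]
  rw [himage]
  exact (isPreconnected_Ioi.prod (isPreconnected_sphere hE 0 1)).image _ (by fun_prop)

lemma one_lt_rank_E2 : 1 < Module.rank ℝ E2 := by
  rw [← Module.finrank_eq_rank, finrank_euclideanSpace_fin]
  exact_mod_cast one_lt_two

namespace PC1Curve

lemma isCompact_image (c : PC1Curve) : IsCompact c.image :=
  isCompact_Icc.image_of_continuousOn c.cont

/-- A simple closed curve has a regular point. -/
lemma exists_hasDerivAt_ne_zero {c : PC1Curve} (hc : c.IsSimpleClosed) :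
    ∃ t ∈ Ioo c.a c.b, ∃ d ≠ 0, HasDerivAt c.toFun d t := by
  obtain ⟨s, hs⟩ := c.sm
  by_contra! hcon
  have hdiff : ∀ t ∈ Ioo c.a c.b \ s, DifferentiableAt ℝ c.toFun t := fun t ht =>
    hs t (Ioo_subset_Icc_self ht.1) ht.2
  have hopen : IsOpen (Ioo c.a c.b \ s) := isOpen_Ioo.sdiff s.finite_toSet.isClosed
  obtain ⟨t, ht⟩ : (Ioo c.a c.b \ s).Nonempty :=
    ((Ioo_infinite c.hab).sdiff s.finite_toSet).nonempty
  obtain ⟨r, hr, hball⟩ := Metric.isOpen_iff.1 hopen t ht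
  have ht' : t + r / 2 ∈ Metric.ball t r := by
    simp [abs_of_pos hr.lt, half_lt_self hr]
  have heq := Metric.isOpen_ball.is_const_of_deriv_eq_zero (convex_ball t r).isPreconnected
    (fun u hu => (hdiff u (hball hu)).differentiableWithinAt)
    (fun u hu => by
      by_contra hne
      exact hcon u (hball hu).1 _ hne (hdiff u (hball hu)).hasDerivAt)
    (Metric.mem_ball_self hr) ht'
  have := hc.2 (Ioo_subset_Ico_self (hball (Metric.mem_ball_self hr)).1)
    (Ioo_subset_Ico_self (hball ht').1) heq
  linarith

lemma exists_separated {c : PC1Curve} (hc : c.IsSimpleClosed) :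
    ∃ x ∈ c.imageᶜ, ∃ y ∈ c.imageᶜ, ∀ U ⊆ c.imageᶜ, IsPreconnected U → x ∈ U → y ∉ U := by
  obtain ⟨t, ht, d, hd0, hd⟩ := exists_hasDerivAt_ne_zero hc
  let e : E2 ≃ₗᵢ[ℝ] ℂ :=
    (Complex.isometryOfOrthonormal (EuclideanSpace.basisFun (Fin 2) ℝ)).symm
  have himage : (fun t => e (c.toFun t)) '' Icc c.a c.b = e '' c.image := by
    rw [image, image_image]
  obtain ⟨x, hx, y, hy, hsep⟩ := exists_separated_of_hasDerivAt (γ := fun t => e (c.toFun t)) ht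
    (e.continuous.comp_continuousOn c.cont) (congrArg e hc.1)
    (e.injective.comp_injOn hc.2)
    (e.toContinuousLinearEquiv.hasFDerivAt.comp_hasDerivAt t hd) (by simpa using hd0)
  rw [himage] at hx hy hsep
  have hmem : ∀ z, z ∈ (e '' c.image)ᶜ → e.symm z ∈ c.imageᶜ := fun z hz hz' =>
    hz ⟨_, hz', e.apply_symm_apply z⟩
  refine ⟨e.symm x, hmem x hx, e.symm y, hmem y hy, fun U hU hUc hxU hyU => ?_⟩
  refine hsep (e '' U) ?_ (hUc.image e e.continuous.continuousOn)
    ⟨_, hxU, e.apply_symm_apply x⟩ ⟨_, hyU, e.apply_symm_apply y⟩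
  rintro _ ⟨u, hu, rfl⟩ hu'
  exact hU hu (e.injective.mem_set_image.1 hu')

lemma not_isBounded_compl_closedBall (r : ℝ) :
    ¬ Bornology.IsBounded (Metric.closedBall (0 : E2) r)ᶜ := fun h =>
  NormedSpace.unbounded_univ ℝ E2
    (by simpa using (Metric.isBounded_closedBall (x := (0 : E2)) (r := r)).union h)

/-- A simple closed curve has nonempty interior region. -/
lemma interiorRegion_nonempty {c : PC1Curve} (hc : c.IsSimpleClosed) :
    c.interiorRegion.Nonempty := by
  obtain ⟨x, hx, y, hy, hsep⟩ := exists_separated hc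
  by_contra hempty
  obtain ⟨r, hr⟩ := c.isCompact_image.isBounded.subset_closedBall 0
  set s := max r 0
  have hs : c.image ⊆ Metric.closedBall 0 s :=
    hr.trans (Metric.closedBall_subset_closedBall (le_max_left _ _))
  have hfar : ∀ z ∈ c.imageᶜ,
      (Metric.closedBall (0 : E2) s)ᶜ ⊆ connectedComponentIn c.imageᶜ z := by
    intro z hz
    have hunb : ¬ Bornology.IsBounded (connectedComponentIn c.imageᶜ z) := fun h =>
      hempty ⟨z, hz, h⟩
    obtain ⟨u, hu, hus⟩ : ∃ u ∈ connectedComponentIn c.imageᶜ z, u ∉ Metric.closedBall 0 s := by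
      by_contra! hsub
      exact hunb (Metric.isBounded_closedBall.subset hsub)
    rw [connectedComponentIn_eq hu]
    exact (isPreconnected_compl_closedBall_zero one_lt_rank_E2
      (le_max_right r 0)).subset_connectedComponentIn hus (compl_subset_compl.2 hs)
  obtain ⟨u, hu⟩ : (Metric.closedBall (0 : E2) s)ᶜ.Nonempty := by
    rw [nonempty_iff_ne_empty]
    intro h
    exact not_isBounded_compl_closedBall s (h ▸ Bornology.isBounded_empty)
  have hxy : connectedComponentIn c.imageᶜ x = connectedComponentIn c.imageᶜ y :=
    (connectedComponentIn_eq (hfar x hx hu)).trans (connectedComponentIn_eq (hfar y hy hu)).symm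
  exact hsep _ (connectedComponentIn_subset _ _) isPreconnected_connectedComponentIn
    (mem_connectedComponentIn hx) (hxy ▸ mem_connectedComponentIn hy)

lemma isOpen_interiorRegion (c : PC1Curve) : IsOpen c.interiorRegion := by
  have hopen : IsOpen c.imageᶜ := c.isCompact_image.isClosed.isOpen_compl
  refine isOpen_iff_mem_nhds.2 fun x hx => ?_
  filter_upwards [hopen.connectedComponentIn.mem_nhds (mem_connectedComponentIn hx.1)] with y hy
  exact ⟨connectedComponentIn_subset _ _ hy, connectedComponentIn_eq hy ▸ hx.2⟩

lemma interiorRegion_subset_closedBall {c : PC1Curve} {r : ℝ} (hr : 0 ≤ r)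
    (hc : c.image ⊆ Metric.closedBall 0 r) : c.interiorRegion ⊆ Metric.closedBall 0 r := by
  intro x hx
  by_contra hxr
  exact not_isBounded_compl_closedBall r (hx.2.subset
    ((isPreconnected_compl_closedBall_zero one_lt_rank_E2 hr).subset_connectedComponentIn hxr
      (compl_subset_compl.2 hc)))

end PC1Curve

lemma qf_eq (M : Matrix (Fin 2) (Fin 2) ℝ) (v : E2) :
    qf M v = M 0 0 * v 0 * v 0 + M 0 1 * v 0 * v 1 + (M 1 0 * v 1 * v 0 + M 1 1 * v 1 * v 1) := by
  simp [qf, Fin.sum_univ_two]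

lemma diag_pos {M : Matrix (Fin 2) (Fin 2) ℝ} (hM : ∀ v : E2, v ≠ 0 → 0 < qf M v) (i : Fin 2) :
    0 < M i i := by
  have h := hM (EuclideanSpace.single i 1) (by simp)
  fin_cases i <;> simpa [qf_eq] using h

lemma det_pos_of_qf_pos {M : Matrix (Fin 2) (Fin 2) ℝ} (hs : M.IsSymm)
    (hM : ∀ v : E2, v ≠ 0 → 0 < qf M v) : 0 < M.det := by
  have h00 : 0 < M 0 0 := diag_pos hM 0
  have h := hM !₂[-M 0 1, M 0 0] fun h => h00.ne' (by simpa using congrArg (fun v : E2 => v 1) h)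
  rw [qf_eq] at h
  simp only [Matrix.cons_val_zero, Matrix.cons_val_one] at h
  rw [Matrix.det_fin_two]
  have hsymm : M 1 0 = M 0 1 := hs.apply 0 1
  rw [hsymm] at h ⊢
  refine (mul_pos_iff_of_pos_left h00).1 ?_
  linarith

lemma sqrt_det_le {M : Matrix (Fin 2) (Fin 2) ℝ} {c : ℝ} (hs : M.IsSymm)
    (hM : ∀ v : E2, v ≠ 0 → 0 < qf M v) (hc : ∀ v : E2, qf M v ≤ c * ‖v‖ ^ 2) :
    √M.det ≤ c := by
  have hle : ∀ i, M i i ≤ c := fun i => by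
    have h := hc (EuclideanSpace.single i 1)
    fin_cases i <;> simpa [qf_eq] using h
  have hpos := diag_pos hM
  have hsymm : M 1 0 = M 0 1 := hs.apply 0 1
  refine Real.sqrt_le_iff.2 ⟨(hpos 0).le.trans (hle 0), ?_⟩
  rw [Matrix.det_fin_two, hsymm]
  nlinarith [mul_le_mul (hle 0) (hle 1) (hpos 1).le ((hpos 0).le.trans (hle 0)),
    sq_nonneg (M 0 1)]

lemma areaDensity_pos {g : E2 → Matrix (Fin 2) (Fin 2) ℝ} (hg : IsRiemMetric g) (x : E2) :
    0 < areaDensity g x :=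
  Real.sqrt_pos.2 (det_pos_of_qf_pos (hg.2.1 x) (hg.2.2 x))

lemma setIntegral_areaDensity_pos {g : E2 → Matrix (Fin 2) (Fin 2) ℝ} (hg : IsRiemMetric g)
    (hA : Integrable (areaDensity g)) {s : Set E2} (hs : 0 < volume s) :
    0 < ∫ x in s, areaDensity g x := by
  rw [setIntegral_pos_iff_support_of_nonneg_ae
    (Filter.Eventually.of_forall fun x => (areaDensity_pos hg x).le) hA.integrableOn]
  rwa [Function.support_eq_univ fun x => (areaDensity_pos hg x).ne', univ_inter]

lemma Ain_pos {g : E2 → Matrix (Fin 2) (Fin 2) ℝ} (hg : IsRiemMetric g)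
    (hA : Integrable (areaDensity g)) {c : PC1Curve} (hc : c.IsSimpleClosed) : 0 < Ain g c :=
  setIntegral_areaDensity_pos hg hA
    (c.isOpen_interiorRegion.measure_pos _ (PC1Curve.interiorRegion_nonempty hc))

lemma Aout_pos {g : E2 → Matrix (Fin 2) (Fin 2) ℝ} (hg : IsRiemMetric g)
    (hA : Integrable (areaDensity g)) (c : PC1Curve) : 0 < Aout g c := by
  obtain ⟨r, hr⟩ := c.isCompact_image.isBounded.subset_closedBall 0
  have hsub := PC1Curve.interiorRegion_subset_closedBall (le_max_right r 0)
    (hr.trans (Metric.closedBall_subset_closedBall (le_max_left r 0)))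
  have hcompl := setIntegral_compl c.isOpen_interiorRegion.measurableSet hA
  rw [Aout, totalArea, Ain, ← hcompl]
  refine setIntegral_areaDensity_pos hg hA (lt_of_lt_of_le ?_
    (measure_mono (compl_subset_compl.2 hsub)))
  refine Metric.isClosed_closedBall.isOpen_compl.measure_pos _ ?_
  rw [nonempty_iff_ne_empty]
  intro h
  exact PC1Curve.not_isBounded_compl_closedBall _ (h ▸ Bornology.isBounded_empty)

lemma Ain_le {g : E2 → Matrix (Fin 2) (Fin 2) ℝ} (hg : IsRiemMetric g)
    (hA : Integrable (areaDensity g)) {R c₂ : ℝ} (hR : 0 ≤ R)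
    (hbound : ∀ x ∈ Metric.closedBall (0 : E2) R, ∀ v : E2, qf (g x) v ≤ c₂ * ‖v‖ ^ 2)
    {c : PC1Curve} (hc : c.image ⊆ Metric.closedBall 0 R) :
    Ain g c ≤ c₂ * (volume c.interiorRegion).toReal := by
  have hsub := PC1Curve.interiorRegion_subset_closedBall hR hc
  have hfin : volume c.interiorRegion ≠ ⊤ :=
    ((measure_mono hsub).trans_lt measure_closedBall_lt_top).ne
  calc Ain g c ≤ ∫ _ in c.interiorRegion, c₂ :=
        setIntegral_mono_on hA.integrableOn (integrableOn_const hfin)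
          c.isOpen_interiorRegion.measurableSet fun x hx =>
            sqrt_det_le (hg.2.1 x) (hg.2.2 x) (hbound x (hsub hx))
    _ = c₂ * (volume c.interiorRegion).toReal := by
        rw [setIntegral_const, smul_eq_mul, mul_comm, measureReal_def]

lemma Lg_nonneg (g : E2 → Matrix (Fin 2) (Fin 2) ℝ) (c : PC1Curve) : 0 ≤ Lg g c :=
  intervalIntegral.integral_nonneg c.hab.le fun _ _ => Real.sqrt_nonneg _

lemma Le_nonneg (c : PC1Curve) : 0 ≤ Le c :=
  intervalIntegral.integral_nonneg c.hab.le fun _ _ => norm_nonneg _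

lemma sqrt_mul_Le_le_Lg {g : E2 → Matrix (Fin 2) (Fin 2) ℝ} (hg : IsRiemMetric g) {c₁ c₂ : ℝ}
    (hc₁ : 0 ≤ c₁) (hc₂ : 0 ≤ c₂) {c : PC1Curve}
    (hbound : ∀ x ∈ c.image, ∀ v : E2, c₁ * ‖v‖ ^ 2 ≤ qf (g x) v ∧ qf (g x) v ≤ c₂ * ‖v‖ ^ 2) :
    √c₁ * Le c ≤ Lg g c := by
  by_cases hint : IntervalIntegrable (fun t => ‖deriv c.toFun t‖) volume c.a c.b
  swap
  · rw [Le, intervalIntegral.integral_undef hint, mul_zero]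
    exact Lg_nonneg g c
  have hbd : ∀ t ∈ Icc c.a c.b,
      √c₁ * ‖deriv c.toFun t‖ ≤ √(qf (g (c.toFun t)) (deriv c.toFun t)) ∧
        √(qf (g (c.toFun t)) (deriv c.toFun t)) ≤ √c₂ * ‖deriv c.toFun t‖ := by
    intro t ht
    have h := hbound _ (mem_image_of_mem c.toFun ht) (deriv c.toFun t)
    have hsq : ∀ {k : ℝ}, 0 ≤ k → √(k * ‖deriv c.toFun t‖ ^ 2) = √k * ‖deriv c.toFun t‖ :=
      fun hk => by rw [Real.sqrt_mul hk, Real.sqrt_sq (norm_nonneg _)]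
    exact ⟨hsq hc₁ ▸ Real.sqrt_le_sqrt h.1, hsq hc₂ ▸ Real.sqrt_le_sqrt h.2⟩
  have hcoef : ∀ i j, AEMeasurable (fun t => g (c.toFun t) i j)
      (volume.restrict (Ioc c.a c.b)) := fun i j =>
    (((continuous_apply_apply i j).comp hg.1).comp_continuousOn
      (c.cont.mono Ioc_subset_Icc_self)).aemeasurable measurableSet_Ioc
  have hder : ∀ i, Measurable fun t => deriv c.toFun t i := fun i =>
    (EuclideanSpace.proj (𝕜 := ℝ) i).continuous.measurable.comp (measurable_deriv c.toFun)
  have hmeas : AEStronglyMeasurable (fun t => √(qf (g (c.toFun t)) (deriv c.toFun t)))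
      (volume.restrict (Ioc c.a c.b)) := by
    refine AEMeasurable.aestronglyMeasurable (AEMeasurable.sqrt ?_)
    simp only [qf_eq]
    exact ((((hcoef 0 0).mul (hder 0).aemeasurable).mul (hder 0).aemeasurable).add
      (((hcoef 0 1).mul (hder 0).aemeasurable).mul (hder 1).aemeasurable)).add
      ((((hcoef 1 0).mul (hder 1).aemeasurable).mul (hder 0).aemeasurable).add
      (((hcoef 1 1).mul (hder 1).aemeasurable).mul (hder 1).aemeasurable))
  have hintg : IntervalIntegrable (fun t => √(qf (g (c.toFun t)) (deriv c.toFun t)))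
      volume c.a c.b := by
    rw [intervalIntegrable_iff_integrableOn_Ioc_of_le c.hab.le] at hint ⊢
    refine Integrable.mono' (hint.const_mul √c₂) hmeas ?_
    refine (ae_restrict_iff' measurableSet_Ioc).2 (Filter.Eventually.of_forall fun t ht => ?_)
    rw [Real.norm_of_nonneg (Real.sqrt_nonneg _)]
    exact (hbd t (Ioc_subset_Icc_self ht)).2
  rw [Le, Lg, ← intervalIntegral.integral_const_mul]
  exact intervalIntegral.integral_mono_on c.hab.le (hint.const_mul _) hintg fun t ht =>
    (hbd t ht).1

/-- **Corollary 7.** If `c1·Id ≤ g ≤ c2·Id` on a closed ball `B̄_R`, then for any `C1 > 0`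
there is `δ1 > 0` (one may take `δ1 = 4π c1/(c2 C1)`) such that every piecewise C¹
simple closed curve in `B̄_R` satisfying the planar isoperimetric inequality and
`I(γ) < C1` has `L_g(γ) ≥ δ1`. -/
theorem length_lower_bound_of_small_ratio
    (g : E2 → Matrix (Fin 2) (Fin 2) ℝ) (hg : IsRiemMetric g)
    (hA : Integrable (areaDensity g))
    (R c1 c2 : ℝ) (hR : 0 < R) (hc1 : 0 < c1) (hc12 : c1 ≤ c2)
    (hbound : ∀ x ∈ Metric.closedBall (0 : E2) R, ∀ v : E2,
      c1 * ‖v‖ ^ 2 ≤ qf (g x) v ∧ qf (g x) v ≤ c2 * ‖v‖ ^ 2)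
    (C1 : ℝ) (hC1 : 0 < C1) :
    ∃ δ1 : ℝ, 0 < δ1 ∧
      ∀ c : PC1Curve, c.IsSimpleClosed →
        c.image ⊆ Metric.closedBall (0 : E2) R →
        4 * Real.pi * (volume c.interiorRegion).toReal ≤ (Le c) ^ 2 →
        Iratio g c < C1 →
        δ1 ≤ Lg g c := by
  have hc2 : 0 < c2 := hc1.trans_le hc12
  refine ⟨4 * π * c1 / (c2 * C1), by positivity, fun c hc himg hiso hratio => ?_⟩
  have hin := Ain_pos hg hA hc
  have hout := Aout_pos hg hA c
  have hle := Ain_le hg hA hR.le (fun x hx v => (hbound x hx v).2) himg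
  have hlen := sqrt_mul_Le_le_Lg hg hc1.le hc2.le fun x hx => hbound x (himg hx)
  have hLg := Lg_nonneg g c
  have hsq : c1 * Le c ^ 2 ≤ Lg g c ^ 2 := by
    have h := pow_le_pow_left₀ (mul_nonneg (Real.sqrt_nonneg _) (Le_nonneg c)) hlen 2
    rwa [mul_pow, Real.sq_sqrt hc1.le] at h
  have harea : 4 * π * c1 * Ain g c ≤ c2 * Lg g c ^ 2 := by
    calc 4 * π * c1 * Ain g c
        ≤ 4 * π * c1 * (c2 * (volume c.interiorRegion).toReal) := by gcongr
      _ = c2 * (c1 * (4 * π * (volume c.interiorRegion).toReal)) := by ring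
      _ ≤ c2 * (c1 * Le c ^ 2) := by gcongr
      _ ≤ c2 * Lg g c ^ 2 := by gcongr
  have hLg0 : 0 < Lg g c := by
    refine hLg.lt_of_ne' fun h => ?_
    rw [h] at harea
    have : 0 < 4 * π * c1 * Ain g c := by positivity
    linarith
  have hratio' : Lg g c < C1 * Ain g c := by
    rw [← div_lt_iff₀ hin]
    refine lt_of_le_of_lt ?_ hratio
    rw [Iratio, div_eq_mul_one_div]
    gcongr
    linarith [one_div_pos.2 hout]
  rw [div_le_iff₀ (by positivity)]
  refine le_of_mul_le_mul_right ?_ hin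
  calc 4 * π * c1 * Ain g c ≤ c2 * Lg g c * Lg g c := by linarith
    _ ≤ c2 * Lg g c * (C1 * Ain g c) := by gcongr
    _ = Lg g c * (c2 * C1) * Ain g c := by ring
end
end

section
/- For any positive real numbers α1, α2, A1, A2, A3, one has (α1 + α2)·(1/A2 + 1/(A1 + A3)) ≥ min{ α1·(1/A1 + 1/(A2 + A3)), α2·(1/A3 + 1/(A1 + A2)) }. -/
/-- **Lemma 10.** For any positive real numbers `α1, α2, A1, A2, A3`,
`(α1 + α2)(1/A2 + 1/(A1+A3)) ≥ min{α1(1/A1 + 1/(A2+A3)), α2(1/A3 + 1/(A1+A2))}`. -/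
theorem algebraic_min_inequality (α1 α2 A1 A2 A3 : ℝ)
    (hα1 : 0 < α1) (hα2 : 0 < α2) (hA1 : 0 < A1) (hA2 : 0 < A2) (hA3 : 0 < A3) :
    min (α1 * (1 / A1 + 1 / (A2 + A3))) (α2 * (1 / A3 + 1 / (A1 + A2)))
      ≤ (α1 + α2) * (1 / A2 + 1 / (A1 + A3)) := by
  by_contra! h
  obtain ⟨h1, h2⟩ := lt_min_iff.mp h
  set T := (α1 + α2) * (1 / A2 + 1 / (A1 + A3)) with hT
  have hTpos : 0 < T := by positivity
  have e1 : α1 * (1 / A1 + 1 / (A2 + A3)) = α1 * (A1 + A2 + A3) / (A1 * (A2 + A3)) := by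
    field_simp
    ring
  have e2 : α2 * (1 / A3 + 1 / (A1 + A2)) = α2 * (A1 + A2 + A3) / (A3 * (A1 + A2)) := by
    field_simp
  have e3 : T * (A2 * (A1 + A3)) = (α1 + α2) * (A1 + A2 + A3) := by
    rw [hT]
    field_simp
    ring
  rw [e1, lt_div_iff₀ (by positivity)] at h1
  rw [e2, lt_div_iff₀ (by positivity)] at h2
  have h3 : 0 < T * (A1 * A3) := by positivity
  linarith
end
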